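/- arXiv:2212.07500 — 2 statements merged into one kernel-verified Lean document; each statement's English description precedes it below -/
import Mathlib

section
/- For every natural number n ≥ 1 and every linear map Λ on the space of 2^n × 2^n complex matrices, the Pauli twirl T(Λ) of Λ is diagonal in the Pauli-word basis: for any two distinct functions g, h : Fin n → Fin 4, the trace Tr(P_g · T(Λ)(P_h)) equals 0. (This is the core of Theorem 1: averaging over random Pauli twirling gates tailors an arbitrary error map into stochastic Pauli noise.) -/
open Matrix

/-- The single-qubit Pauli matrices σ₀ = I, σ₁ = X, σ₂ = Y, σ₃ = Z. -/
noncomputable def pauli : Fin 4 → Matrix (Fin 2) (Fin 2) ℂ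
  | 0 => !![1, 0; 0, 1]
  | 1 => !![0, 1; 1, 0]
  | 2 => !![0, -Complex.I; Complex.I, 0]
  | 3 => !![1, 0; 0, -1]

/-- The n-qubit Pauli word `P_f = ⊗ᵢ σ_{f i}`, as a matrix indexed by `Fin n → Fin 2`. -/
noncomputable def pauliWord (n : ℕ) (f : Fin n → Fin 4) :
    Matrix (Fin n → Fin 2) (Fin n → Fin 2) ℂ :=
  Matrix.of fun x y => ∏ i, pauli (f i) (x i) (y i)

/-- The Pauli twirl of a linear map Λ on n-qubit matrices:
`T(Λ)(ρ) = 4^{-n} ∑_f P_f ⬝ Λ(P_f ⬝ ρ ⬝ P_f) ⬝ P_f`. -/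
noncomputable def pauliTwirl {n : ℕ}
    (Λ : Matrix (Fin n → Fin 2) (Fin n → Fin 2) ℂ →ₗ[ℂ]
         Matrix (Fin n → Fin 2) (Fin n → Fin 2) ℂ)
    (ρ : Matrix (Fin n → Fin 2) (Fin n → Fin 2) ℂ) :
    Matrix (Fin n → Fin 2) (Fin n → Fin 2) ℂ :=
  ((4 : ℂ) ^ n)⁻¹ • ∑ f : Fin n → Fin 4,
    pauliWord n f * Λ (pauliWord n f * ρ * pauliWord n f) * pauliWord n f

/-- The sign `s` with `σ_a σ_b σ_a = s σ_b`: `1` if the two Pauli matrices commute, `-1` otherwise. -/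
def pauliSign (a b : Fin 4) : ℤ :=
  if a = 0 ∨ b = 0 ∨ a = b then 1 else -1

lemma pauli_mul_mul_self (a b : Fin 4) :
    pauli a * pauli b * pauli a = (pauliSign a b : ℂ) • pauli b := by
  fin_cases a <;> fin_cases b <;> ext i j <;> fin_cases i <;> fin_cases j <;>
    simp [pauli, pauliSign, Matrix.mul_apply, Fin.sum_univ_two]

lemma sum_pauliSign_mul_pauliSign {b c : Fin 4} (hbc : b ≠ c) :
    ∑ a, pauliSign a b * pauliSign a c = 0 := by
  revert b c
  decide

/-- Products of Kronecker products are computed factorwise. -/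
lemma of_prod_mul_of_prod {ι m R : Type*} [Fintype ι] [DecidableEq ι] [Fintype m]
    [CommSemiring R] (A B : ι → Matrix m m R) :
    (Matrix.of fun x y : ι → m => ∏ i, A i (x i) (y i)) *
        (Matrix.of fun x y : ι → m => ∏ i, B i (x i) (y i)) =
      Matrix.of fun x y : ι → m => ∏ i, (A i * B i) (x i) (y i) := by
  ext x y
  simp [Matrix.mul_apply, Fintype.prod_sum, Finset.prod_mul_distrib]

lemma pauliWord_mul_mul_self {n : ℕ} (f g : Fin n → Fin 4) :
    pauliWord n f * pauliWord n g * pauliWord n f =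
      ((∏ i, pauliSign (f i) (g i) : ℤ) : ℂ) • pauliWord n g := by
  unfold pauliWord
  rw [of_prod_mul_of_prod, of_prod_mul_of_prod (fun i => pauli (f i) * pauli (g i))]
  ext x y
  simp [pauli_mul_mul_self, Finset.prod_mul_distrib]

lemma sum_prod_pauliSign_mul {n : ℕ} {g h : Fin n → Fin 4} (hgh : g ≠ h) :
    ∑ f : Fin n → Fin 4,
      (∏ i, pauliSign (f i) (g i)) * ∏ i, pauliSign (f i) (h i) = 0 := by
  obtain ⟨i, hi⟩ := Function.ne_iff.mp hgh
  simp_rw [← Finset.prod_mul_distrib]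
  rw [← Fintype.prod_sum fun i a => pauliSign a (g i) * pauliSign a (h i)]
  exact Finset.prod_eq_zero (Finset.mem_univ i) (sum_pauliSign_mul_pauliSign hi)

lemma trace_pauliWord_mul_twirl_term {n : ℕ}
    (Λ : Matrix (Fin n → Fin 2) (Fin n → Fin 2) ℂ →ₗ[ℂ]
         Matrix (Fin n → Fin 2) (Fin n → Fin 2) ℂ)
    (f g h : Fin n → Fin 4) :
    Matrix.trace (pauliWord n g * (pauliWord n f *
        Λ (pauliWord n f * pauliWord n h * pauliWord n f) * pauliWord n f)) =
      (((∏ i, pauliSign (f i) (g i)) * ∏ i, pauliSign (f i) (h i) : ℤ) : ℂ) *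
        Matrix.trace (pauliWord n g * Λ (pauliWord n h)) := by
  rw [← Matrix.mul_assoc, Matrix.trace_mul_comm, ← Matrix.mul_assoc, ← Matrix.mul_assoc,
    pauliWord_mul_mul_self, pauliWord_mul_mul_self, map_smul, Matrix.smul_mul, Matrix.mul_smul,
    smul_smul, Matrix.trace_smul, smul_eq_mul, Int.cast_mul]

/-- The Pauli twirl of an arbitrary linear map is diagonal in the Pauli-word basis:
for distinct Pauli words `P_g`, `P_h`, we have `Tr(P_g ⬝ T(Λ)(P_h)) = 0`. -/
theorem pauliTwirl_offDiagonal_eq_zero (n : ℕ) (hn : 1 ≤ n)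
    (Λ : Matrix (Fin n → Fin 2) (Fin n → Fin 2) ℂ →ₗ[ℂ]
         Matrix (Fin n → Fin 2) (Fin n → Fin 2) ℂ)
    (g h : Fin n → Fin 4) (hgh : g ≠ h) :
    Matrix.trace (pauliWord n g * pauliTwirl Λ (pauliWord n h)) = 0 := by
  simp_rw [pauliTwirl, Matrix.mul_smul, Matrix.trace_smul, Finset.mul_sum, Matrix.trace_sum,
    trace_pauliWord_mul_twirl_term]
  rw [← Finset.sum_mul, ← Int.cast_sum, sum_prod_pauliSign_mul hgh, Int.cast_zero, zero_mul,
    smul_zero]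
end

section
/- The n-qubit Pauli group is a unitary 1-design: for every 2^n × 2^n complex matrix M, 4^{-n} ∑_{f : Fin n → Fin 4} P_f · M · P_f = (2^{-n} · Tr M) • I, where I is the identity matrix. -/
open Matrix

/-- Completeness relation of the Pauli matrices. -/
theorem sum_pauli_mul_pauli (x u v y : Fin 2) :
    ∑ a, pauli a x u * pauli a v y = if x = y ∧ u = v then 2 else 0 := by
  fin_cases x <;> fin_cases u <;> fin_cases v <;> fin_cases y <;>
    norm_num [Fin.sum_univ_four, pauli]

/-- Completeness relation of the Pauli words. -/
theorem sum_pauliWord_mul_pauliWord (n : ℕ) (x u v y : Fin n → Fin 2) :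
    ∑ f, pauliWord n f x u * pauliWord n f v y = if x = y ∧ u = v then 2 ^ n else 0 := by
  simp only [pauliWord, of_apply, ← Finset.prod_mul_distrib]
  rw [← Fintype.prod_sum fun i a => pauli a (x i) (u i) * pauli a (v i) (y i)]
  simp only [sum_pauli_mul_pauli, Finset.prod_ite_zero, Finset.mem_univ, forall_const,
    forall_and, funext_iff, Finset.prod_const, Finset.card_univ, Fintype.card_fin]

/-- The n-qubit Pauli group is a unitary 1-design:
`4^{-n} ∑_f P_f ⬝ M ⬝ P_f = (2^{-n} Tr M) • I`. -/
theorem pauliGroup_unitary_one_design (n : ℕ)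
    (M : Matrix (Fin n → Fin 2) (Fin n → Fin 2) ℂ) :
    ((4 : ℂ) ^ n)⁻¹ • ∑ f : Fin n → Fin 4, pauliWord n f * M * pauliWord n f =
      (((2 : ℂ) ^ n)⁻¹ * Matrix.trace M) • (1 : Matrix (Fin n → Fin 2) (Fin n → Fin 2) ℂ) := by
  have key : ∑ f : Fin n → Fin 4, pauliWord n f * M * pauliWord n f =
      (2 ^ n * trace M) • (1 : Matrix (Fin n → Fin 2) (Fin n → Fin 2) ℂ) := by
    ext x y
    calc (∑ f, pauliWord n f * M * pauliWord n f) x y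
        = ∑ v, ∑ u, M u v * ∑ f, pauliWord n f x u * pauliWord n f v y := by
          simp only [Matrix.sum_apply, mul_apply, Finset.sum_mul, Finset.mul_sum]
          rw [Finset.sum_comm]
          refine Finset.sum_congr rfl fun v _ => ?_
          rw [Finset.sum_comm]
          refine Finset.sum_congr rfl fun u _ => Finset.sum_congr rfl fun f _ => ?_
          ring
      _ = _ := by
          by_cases h : x = y <;>
            simp [sum_pauliWord_mul_pauliWord, h, trace, Finset.mul_sum, mul_comm]
  rw [key, smul_smul, ← mul_assoc, show (4 : ℂ) = 2 * 2 by norm_num, mul_pow]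
  congr 2
  field_simp
end
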